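/- arXiv:2208.07229 — 2 statements merged into one kernel-verified Lean document; each statement's English description precedes it below -/
import Mathlib

section
/- For every integer m ≥ 1 and every real (or complex) number λ, the resultant of the polynomials S_m(x) − λ·S_{m−1}(x) and S_{m−1}(x) equals (−1)^{m(m−1)/2}. Equivalently, if μ^{(1)}, …, μ^{(m)} are the roots (with multiplicity, over ℂ) of S_m(x) − λ·S_{m−1}(x), then ∏_{j=1}^m S_{m−1}(μ^{(j)}) = (−1)^{m(m−1)/2}; in particular S_{m−1}(μ^{(j)}) ≠ 0 for every j. -/
open Polynomial

/-- The renormalized Chebyshev polynomial of the second kind, `S k x = U k (x/2)`. -/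
noncomputable def chebS (k : ℤ) : Polynomial ℂ :=
  (Polynomial.Chebyshev.U ℂ k).comp (Polynomial.C 2⁻¹ * Polynomial.X)

/-- The resultant of two complex polynomials `f = aₙ∏(x-αᵢ)`, `g = bₘ∏(x-βⱼ)`:
`Res(f,g) = aₙ^m · bₘ^n · ∏ᵢⱼ (αᵢ - βⱼ)`. -/
noncomputable def res (f g : Polynomial ℂ) : ℂ :=
  f.leadingCoeff ^ g.natDegree * g.leadingCoeff ^ f.natDegree *
    (f.roots.map fun a => (g.roots.map fun b => a - b).prod).prod

theorem Polynomial.Chebyshev.monic_S_and_natDegree_S {R : Type*} [CommRing R] [Nontrivial R]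
    (n : ℕ) : (Chebyshev.S R n).Monic ∧ (Chebyshev.S R n).natDegree = n := by
  induction n using Nat.twoStepInduction with
  | zero => simp
  | one => simp [monic_X]
  | more n ih₀ ih₁ =>
    obtain ⟨-, hd₀⟩ := ih₀
    obtain ⟨hm₁, hd₁⟩ := ih₁
    push_cast at hm₁ hd₁ ⊢
    rw [Chebyshev.S_add_two]
    have hd : (X * Chebyshev.S R ((n : ℤ) + 1)).natDegree = n + 2 := by
      rw [natDegree_X_mul hm₁.ne_zero, hd₁]
    have hlt : (Chebyshev.S R n).natDegree < (X * Chebyshev.S R ((n : ℤ) + 1)).natDegree := by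
      lia
    exact ⟨(monic_X.mul hm₁).sub_of_left (degree_lt_degree hlt),
      (natDegree_sub_eq_left_of_natDegree_lt hlt).trans hd⟩

theorem Polynomial.Chebyshev.resultant_S_succ_S {R : Type*} [CommRing R] [Nontrivial R] (n : ℕ) :
    resultant (Chebyshev.S R ((n : ℤ) + 1)) (Chebyshev.S R n) (n + 1) n =
      (-1) ^ ((n + 1) * n / 2) := by
  induction n with
  | zero => simp
  | succ n ih =>
    have hd₀ := (monic_S_and_natDegree_S (R := R) n).2
    obtain ⟨hm₁, hd₁⟩ := monic_S_and_natDegree_S (R := R) (n + 1)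
    push_cast at hm₁ hd₁ ⊢
    have hc : (Chebyshev.S R ((n : ℤ) + 1)).coeff (n + 1) = 1 :=
      hd₁ ▸ hm₁.coeff_natDegree
    have hrec : Chebyshev.S R ((n : ℤ) + 1 + 1) =
        Polynomial.C (-1) * Chebyshev.S R n + Chebyshev.S R ((n : ℤ) + 1) * X := by
      rw [add_assoc, one_add_one_eq_two, Chebyshev.S_add_two, Polynomial.C_neg, Polynomial.C_1]
      ring
    have hexp : (n + 1 + 1) * (n + 1) / 2 = (n + 1) + (n + 1) * n / 2 := by
      rw [show (n + 1 + 1) * (n + 1) = (n + 1) * n + (n + 1) * 2 by ring,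
        Nat.add_mul_div_right _ _ two_pos, add_comm]
    rw [hrec, resultant_add_mul_left _ _ _ _ _ (by rw [natDegree_X]; lia) hd₁.le,
      resultant_C_mul_left, resultant_add_left_deg _ _ _ _ 2 hd₀.le, resultant_comm, ih, hc, hexp,
      pow_add _ (n + 1), (Nat.even_mul_succ_self n).neg_one_pow,
      (even_two.mul_left (n + 1)).neg_one_pow]
    simp

theorem chebS_eq_S (k : ℤ) : chebS k = Chebyshev.S ℂ k := by
  simp [chebS, Chebyshev.S_eq_U_comp_half_mul_X, invOf_eq_inv]

theorem res_eq_prod_eval {f g : ℂ[X]} (hf : f.Monic) (hg : g.Monic) :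
    res f g = (f.roots.map g.eval).prod := by
  simp [res, hf.leadingCoeff, hg.leadingCoeff,
    fun a => (IsAlgClosed.splits g).eval_eq_prod_roots_of_monic hg a]

theorem resultant_chebS_combination_chebS (m : ℕ) (hm : 1 ≤ m) (lam : ℂ) :
    res (chebS m - C lam * chebS ((m : ℤ) - 1)) (chebS ((m : ℤ) - 1)) =
        (-1) ^ (m * (m - 1) / 2) ∧
    ((chebS m - C lam * chebS ((m : ℤ) - 1)).roots.map fun mu =>
          (chebS ((m : ℤ) - 1)).eval mu).prod =
        (-1) ^ (m * (m - 1) / 2) ∧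
    ∀ mu ∈ (chebS m - C lam * chebS ((m : ℤ) - 1)).roots,
      (chebS ((m : ℤ) - 1)).eval mu ≠ 0 := by
  obtain ⟨n, rfl⟩ := Nat.exists_eq_add_of_le' hm
  obtain ⟨hm₀, hd₀⟩ := Chebyshev.monic_S_and_natDegree_S (R := ℂ) n
  obtain ⟨hm₁, hd₁⟩ := Chebyshev.monic_S_and_natDegree_S (R := ℂ) (n + 1)
  push_cast at hm₁ hd₁
  simp only [chebS_eq_S, Nat.cast_add, Nat.cast_one, add_sub_cancel_right, Nat.add_sub_cancel]
  set f := Chebyshev.S ℂ ((n : ℤ) + 1) - C lam * Chebyshev.S ℂ n with hf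
  have hlt : (C lam * Chebyshev.S ℂ n).natDegree < (Chebyshev.S ℂ ((n : ℤ) + 1)).natDegree :=
    (natDegree_C_mul_le _ _).trans_lt (by lia)
  have hfm : f.Monic := hm₁.sub_of_left (degree_lt_degree hlt)
  have hfd : f.natDegree = n + 1 := (natDegree_sub_eq_left_of_natDegree_lt hlt).trans hd₁
  have hprod : (f.roots.map (Chebyshev.S ℂ n).eval).prod = (-1) ^ ((n + 1) * n / 2) := by
    have h := resultant_eq_prod_eval f (Chebyshev.S ℂ n) n hd₀.le (IsAlgClosed.splits f)
    rw [hfm.leadingCoeff, one_pow, one_mul, hfd] at h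
    rw [← h, ← Chebyshev.resultant_S_succ_S,
      show f = Chebyshev.S ℂ ((n : ℤ) + 1) + Chebyshev.S ℂ n * C (-lam) by
        rw [hf, C_neg]; ring,
      resultant_add_mul_left _ _ _ _ _ (by simp) hd₀.le]
  refine ⟨(res_eq_prod_eval hfm hm₀).trans hprod, hprod, fun mu hmu h => ?_⟩
  have hzero : (f.roots.map (Chebyshev.S ℂ n).eval).prod = 0 :=
    Multiset.prod_eq_zero (Multiset.mem_map.mpr ⟨mu, hmu, h⟩)
  exact pow_ne_zero _ (neg_ne_zero.mpr one_ne_zero) (hprod.symm.trans hzero)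
end

section
/- Let λ_1, …, λ_n be complex numbers and m ≥ 1, and for each i = 1,…,n let μ_i^{(1)}, …, μ_i^{(m)} be complex numbers with S_m(x) − λ_i·S_{m−1}(x) = ∏_{j=1}^m (x − μ_i^{(j)}). Order the index pairs (i,j) co-lexicographically ((i₁,j₁) < (i₂,j₂) iff j₁ < j₂, or j₁ = j₂ and i₁ < i₂), and let V be the mn×mn Vandermonde matrix whose column indexed by (i,j) is (1, μ_i^{(j)}, (μ_i^{(j)})², …, (μ_i^{(j)})^{mn−1})ᵀ. Then det V = (∏_{i=1}^n ∏_{1≤j₁<j₂≤m} (μ_i^{(j₂)} − μ_i^{(j₁)})) · (∏_{1≤i₁<i₂≤n} (λ_{i₂} − λ_{i₁}))^m. -/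
open Polynomial Matrix

theorem chebS_add_one (k : ℤ) : chebS (k + 1) = X * chebS k - chebS (k - 1) := by
  have hC : (2 : ℂ[X]) * C 2⁻¹ = 1 := by
    rw [← C_ofNat, ← C_mul, mul_inv_cancel₀ two_ne_zero, C_1]
  simp only [chebS, Chebyshev.U_add_one, sub_comp, mul_comp, ofNat_comp, X_comp]
  linear_combination X * (Chebyshev.U ℂ k).comp (C 2⁻¹ * X) * hC

theorem natDegree_chebS (m : ℕ) : (chebS m).natDegree = m := by
  rw [chebS, natDegree_comp, natDegree_C_mul_X _ (by norm_num), Chebyshev.natDegree_U_natCast,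
    mul_one]

theorem monic_chebS (m : ℕ) : (chebS m).Monic := by
  rw [Monic, chebS, leadingCoeff_comp (by rw [natDegree_C_mul_X _ (by norm_num)]; norm_num),
    Chebyshev.leadingCoeff_U_natCast, leadingCoeff_C_mul_X, Chebyshev.natDegree_U_natCast,
    ← mul_pow, mul_inv_cancel₀ two_ne_zero, one_pow]

theorem Polynomial.Monic.exists_eq_prod_X_sub_C {K : Type*} [Field K] [IsAlgClosed K]
    {p : K[X]} (hp : p.Monic) {m : ℕ} (hm : p.natDegree = m) :
    ∃ ν : Fin m → K, p = ∏ k, (X - C (ν k)) := by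
  have hs := IsAlgClosed.splits p
  obtain ⟨l, hl⟩ := Quot.exists_rep p.roots
  replace hl : (l : Multiset K) = p.roots := hl
  have hlen : l.length = m := by
    rw [← hm, hs.natDegree_eq_card_roots, ← hl, Multiset.coe_card]
  subst hlen
  refine ⟨l.get, ?_⟩
  conv_lhs => rw [hs.eq_prod_roots_of_monic hp, ← hl]
  rw [Multiset.map_coe, Multiset.prod_coe, ← List.ofFn_get (l.map _), List.prod_ofFn]
  exact Fintype.prod_equiv (finCongr (by simp)) _ _ (by simp)

/-- The resultant of `chebS m - C l * chebS (m - 1)` and `chebS (m - 1)`, as a product over the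
roots of the former. -/
theorem prod_eval_chebS (m : ℕ) : ∀ (l : ℂ) (μ : Fin m → ℂ),
    chebS m - C l * chebS ((m : ℤ) - 1) = ∏ j, (X - C (μ j)) →
      ∏ j, (chebS ((m : ℤ) - 1)).eval (μ j) = ∏ j : Fin m, (-1) ^ (j : ℕ) := by
  induction m with
  | zero => simp
  | succ m ih =>
    intro l μ hμ
    obtain ⟨ν, hν⟩ := (monic_chebS m).exists_eq_prod_X_sub_C (natDegree_chebS m)
    have hroot (k : Fin m) : (chebS m).eval (ν k) = 0 := by
      rw [hν, eval_prod]
      exact Finset.prod_eq_zero (Finset.mem_univ k) (by simp)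
    push_cast at hμ ⊢
    rw [add_sub_cancel_right] at hμ ⊢
    have heval (k : Fin m) :
        ∏ j, (μ j - ν k) = (-1) ^ m * (chebS ((m : ℤ) - 1)).eval (ν k) := by
      have h := congrArg (eval (ν k)) hμ
      rw [chebS_add_one] at h
      simp only [eval_sub, eval_mul, hroot, mul_zero, zero_sub, sub_zero, eval_prod, eval_X,
        eval_C] at h
      simp_rw [← neg_sub (ν k), Finset.prod_neg, ← h]
      simp [pow_succ]
    have hone : ∏ _k : Fin m, (-1 : ℂ) ^ m = (-1) ^ m := by
      rcases Nat.even_or_odd m with h | h <;> simp [h.neg_one_pow]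
    calc ∏ j, (chebS m).eval (μ j) = ∏ j, ∏ k, (μ j - ν k) := by
          rw [hν]; simp [eval_prod]
      _ = ∏ k, ∏ j, (μ j - ν k) := Finset.prod_comm
      _ = (-1) ^ m * ∏ k, (chebS ((m : ℤ) - 1)).eval (ν k) := by
          simp_rw [heval, Finset.prod_mul_distrib, hone]
      _ = _ := by
          rw [ih 0 ν (by simpa using hν), Fin.prod_univ_castSucc, mul_comm]
          simp

theorem prod_prod_sub_of_roots {m : ℕ} {l₁ l₂ : ℂ} {μ₁ μ₂ : Fin m → ℂ}
    (h₁ : chebS m - C l₁ * chebS ((m : ℤ) - 1) = ∏ j, (X - C (μ₁ j)))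
    (h₂ : chebS m - C l₂ * chebS ((m : ℤ) - 1) = ∏ j, (X - C (μ₂ j))) :
    ∏ j₁, ∏ j₂, (μ₂ j₂ - μ₁ j₁) = (l₂ - l₁) ^ m * ∏ j : Fin m, (-1) ^ (j : ℕ) := by
  have heval (j₂ : Fin m) :
      ∏ j₁, (μ₂ j₂ - μ₁ j₁) = (l₂ - l₁) * (chebS ((m : ℤ) - 1)).eval (μ₂ j₂) := by
    have e₁ := congrArg (eval (μ₂ j₂)) h₁
    have e₂ := congrArg (eval (μ₂ j₂)) h₂
    have hzero : ∏ j, (μ₂ j₂ - μ₂ j) = 0 :=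
      Finset.prod_eq_zero (Finset.mem_univ j₂) (sub_self _)
    simp only [eval_sub, eval_mul, eval_prod, eval_X, eval_C, hzero] at e₁ e₂
    linear_combination e₂ - e₁
  rw [Finset.prod_comm]
  simp_rw [heval, Finset.prod_mul_distrib, prod_eval_chebS m l₂ μ₂ h₂]
  simp

theorem prod_prod_ite_lt_neg_one (R : Type*) [CommRing R] (m : ℕ) :
    ∏ j₁ : Fin m, ∏ j₂ : Fin m, (if j₂ < j₁ then (-1 : R) else 1) =
      ∏ j : Fin m, (-1) ^ (j : ℕ) := by
  refine Finset.prod_congr rfl fun j _ => ?_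
  rw [Finset.prod_ite, Finset.prod_const, Finset.prod_const_one, mul_one]
  congr 1
  rw [← Fin.card_Iio j]
  congr 1
  ext; simp

theorem prod_prod_Ioi_eq_prod_prod_ite {α M : Type*} [Fintype α] [LinearOrder α]
    [LocallyFiniteOrderTop α] [CommMonoid M] (f : α → α → M) :
    ∏ a, ∏ b ∈ Finset.Ioi a, f a b = ∏ a, ∏ b, if a < b then f a b else 1 := by
  refine Finset.prod_congr rfl fun a _ => ?_
  rw [← Finset.prod_filter]
  congr 1
  ext; simp

theorem prod_prod_eq_diag_mul_Ioi {α M : Type*} [Fintype α] [LinearOrder α]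
    [LocallyFiniteOrderTop α] [LocallyFiniteOrderBot α] [CommMonoid M] (f : α → α → M) :
    ∏ a, ∏ b, f a b = (∏ a, f a a) * ∏ a, ∏ b ∈ Finset.Ioi a, f a b * f b a := by
  have h := Finset.prod_prod_Ioi_mul_eq_prod_prod_off_diag fun a b => f b a
  rw [h, ← Finset.prod_mul_distrib]
  exact Finset.prod_congr rfl fun a _ => Fintype.prod_eq_mul_prod_compl a _

theorem finProdFinEquiv_lt_iff {m n : ℕ} {j₁ j₂ : Fin m} {i₁ i₂ : Fin n} :
    finProdFinEquiv (j₁, i₁) < finProdFinEquiv (j₂, i₂) ↔ j₁ < j₂ ∨ j₁ = j₂ ∧ i₁ < i₂ := by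
  rw [Fin.lt_def, Fin.lt_def, Fin.lt_def, Fin.ext_iff, finProdFinEquiv_apply_val,
    finProdFinEquiv_apply_val]
  have h₁ := i₁.isLt
  have h₂ := i₂.isLt
  rcases lt_trichotomy (j₁ : ℕ) j₂ with h | h | h
  · have := Nat.mul_le_mul_left n (Nat.succ_le_of_lt h)
    rw [Nat.succ_eq_add_one, mul_add] at this
    dsimp only
    omega
  · simp [h]
  · have := Nat.mul_le_mul_left n (Nat.succ_le_of_lt h)
    rw [Nat.succ_eq_add_one, mul_add] at this
    dsimp only
    omega

/-- The Vandermonde product in co-lexicographic order, with the factors grouped by the pair of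
indices `i₁, i₂`. -/
theorem prod_Ioi_modNat_divNat {R : Type*} [CommRing R] {m n : ℕ} (mu : Fin n → Fin m → R) :
    ∏ c₁ : Fin (m * n), ∏ c₂ ∈ Finset.Ioi c₁,
        (mu c₂.modNat c₂.divNat - mu c₁.modNat c₁.divNat) =
      (∏ i : Fin n, ∏ j₁ : Fin m, ∏ j₂ ∈ Finset.Ioi j₁, (mu i j₂ - mu i j₁)) *
        ∏ i₁ : Fin n, ∏ i₂ ∈ Finset.Ioi i₁,
          (∏ j₁, ∏ j₂, (mu i₂ j₂ - mu i₁ j₁)) * ∏ j : Fin m, (-1) ^ (j : ℕ) := by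
  let F (i₁ i₂ : Fin n) : R := ∏ j₁ : Fin m, ∏ j₂ : Fin m,
    if j₁ < j₂ ∨ j₁ = j₂ ∧ i₁ < i₂ then mu i₂ j₂ - mu i₁ j₁ else 1
  have hsymm (c : Fin m × Fin n) :
      ((finProdFinEquiv c).divNat, (finProdFinEquiv c).modNat) = c :=
    finProdFinEquiv.symm_apply_apply c
  have hdiv (c : Fin m × Fin n) : (finProdFinEquiv c).divNat = c.1 := congrArg Prod.fst (hsymm c)
  have hmod (c : Fin m × Fin n) : (finProdFinEquiv c).modNat = c.2 := congrArg Prod.snd (hsymm c)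
  have hF : ∏ c₁ : Fin (m * n), ∏ c₂ ∈ Finset.Ioi c₁,
      (mu c₂.modNat c₂.divNat - mu c₁.modNat c₁.divNat) = ∏ i₁, ∏ i₂, F i₁ i₂ := by
    rw [prod_prod_Ioi_eq_prod_prod_ite, ← finProdFinEquiv.prod_comp]
    simp_rw [← finProdFinEquiv.prod_comp (M := R), hdiv, hmod, Fintype.prod_prod_type_right,
      finProdFinEquiv_lt_iff, F]
    exact Finset.prod_congr rfl fun i₁ _ => Finset.prod_comm
  rw [hF, prod_prod_eq_diag_mul_Ioi]
  congr 1
  · simp [F, prod_prod_Ioi_eq_prod_prod_ite]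
  · refine Finset.prod_congr rfl fun i₁ _ => Finset.prod_congr rfl fun i₂ hi => ?_
    rw [Finset.mem_Ioi] at hi
    have hswap : F i₂ i₁ = ∏ j₁ : Fin m, ∏ j₂ : Fin m,
        if j₂ < j₁ ∨ j₂ = j₁ ∧ i₂ < i₁ then mu i₁ j₁ - mu i₂ j₂ else 1 := Finset.prod_comm
    rw [hswap, ← prod_prod_ite_lt_neg_one]
    simp_rw [F, ← Finset.prod_mul_distrib]
    refine Finset.prod_congr rfl fun j₁ _ => Finset.prod_congr rfl fun j₂ _ => ?_
    rcases lt_trichotomy j₁ j₂ with h | h | h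
    · simp [h, h.not_gt, h.ne']
    · simp [h, hi, hi.not_gt]
    · simp [h, h.not_gt, h.ne']

theorem det_vandermonde_of_roots {n : ℕ} (m : ℕ) (hm : 1 ≤ m)
    (lam : Fin n → ℂ) (mu : Fin n → Fin m → ℂ)
    (hmu : ∀ i, chebS m - C (lam i) * chebS ((m : ℤ) - 1) =
      ∏ j : Fin m, (X - C (mu i j)))
    (V : Matrix (Fin (m * n)) (Fin (m * n)) ℂ)
    -- the column of `V` indexed by `c = j·n + i` (co-lexicographic order on the
    -- pairs `(i, j)`) is `(1, μᵢ⁽ʲ⁾, (μᵢ⁽ʲ⁾)², …, (μᵢ⁽ʲ⁾)^{mn-1})ᵀ`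
    (hV : V = Matrix.of fun r c : Fin (m * n) =>
      mu c.modNat c.divNat ^ (r : ℕ)) :
    V.det =
      (∏ i : Fin n, ∏ j₁ : Fin m, ∏ j₂ ∈ Finset.Ioi j₁, (mu i j₂ - mu i j₁)) *
        (∏ i₁ : Fin n, ∏ i₂ ∈ Finset.Ioi i₁, (lam i₂ - lam i₁)) ^ m := by
  have hVt : V = (vandermonde fun c : Fin (m * n) => mu c.modNat c.divNat)ᵀ := by
    rw [hV]
    ext r c
    simp [vandermonde_apply]
  have hsq : (∏ j : Fin m, (-1 : ℂ) ^ (j : ℕ)) * ∏ j : Fin m, (-1 : ℂ) ^ (j : ℕ) = 1 := by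
    rw [← Finset.prod_mul_distrib]
    exact Finset.prod_eq_one fun j _ => by rw [← mul_pow]; simp
  rw [hVt, det_transpose, det_vandermonde, prod_Ioi_modNat_divNat]
  simp_rw [prod_prod_sub_of_roots (hmu _) (hmu _), mul_assoc, hsq, mul_one, Finset.prod_pow]
end
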